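/- Let M, N ≥ 2, J ≥ 1, L_1,…,L_J ≥ 1 with ∑_{j=1}^J L_j² ≥ (N−1)(M−1), and T = M+N−1. Fix a receiver index n ∈ {1,…,N} and a time slot t ∈ {N+1,…,T}, and set m' = t−N. Let channel data be given: nonzero scalars h_{nm}(τ) ∈ ℂ for all τ ∈ {1,…,N} and m ∈ {1,…,M}, scalars h_{nm'}(t) ∈ ℂ, vectors f_{jm}(τ) ∈ ℂ^{L_j} and g_{nj}(t) ∈ ℂ^{L_j}. Suppose that for each τ ∈ {1,…,N} the associated alignment matrix V(t,τ) (rows indexed by receivers ν ≠ τ and transmitters m ≠ m', row = concatenation over j of (h_{νm'}(τ) f_{jm}(τ) − h_{νm}(τ) f_{jm'}(τ))ᵀ ⊗ g_{νj}ᵀ(t)) has full row rank, where now data h_{νm}(τ), g_{νj}(t) are given for all receivers ν. Then there exist precoding matrices R_j(t,τ) ∈ ℂ^{L_j×L_j} such that for every receiver ν, every τ ≠ ν and every m ≠ m': (s_{νm'}(t,τ) + h_{νm'}(t))/h_{νm'}(τ) = s_{νm}(t,τ)/h_{νm}(τ), where s_{νm}(t,τ) = ∑_{j=1}^J g_{νj}ᵀ(t)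 R_j(t,τ) f_{jm}(τ). -/

import Mathlib

open Matrix

/-- The alignment coefficient matrix `V(t,τ)` (for `n₀ = τ`): its row indexed
by the pair `(ν, m)` with `ν ≠ τ`, `m ≠ m'` is the concatenation over `j` of
the Kronecker products of row vectors
`(h_{ν m'}(τ) f_{j m}(τ) − h_{ν m}(τ) f_{j m'}(τ))ᵀ ⊗ g_{ν j}ᵀ(t)`. -/
noncomputable def Vmat (N M J : ℕ) (L : Fin J → ℕ) (n₀ : Fin N) (m' : Fin M)
    (g : Fin N → ∀ j : Fin J, Fin (L j) → ℂ)
    (f : ∀ j : Fin J, Fin M → Fin (L j) → ℂ)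
    (h : Fin N → Fin M → ℂ) :
    Matrix ({n : Fin N // n ≠ n₀} × {m : Fin M // m ≠ m'})
      (Σ j : Fin J, Fin (L j) × Fin (L j)) ℂ :=
  Matrix.of fun nm q =>
    (h nm.1.1 m' * f q.1 nm.2.1 q.2.1 - h nm.1.1 nm.2.1 * f q.1 m' q.2.1)
      * g nm.1.1 q.1 q.2.2

/-- A matrix over a field whose rank is its number of rows acts surjectively. -/
theorem Matrix.mulVec_surjective_of_rank_eq_card {ι κ K : Type*} [Fintype ι] [Fintype κ]
    [Field K] {A : Matrix ι κ K} (hA : A.rank = Fintype.card ι) :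
    Function.Surjective A.mulVec := by
  have hrange : LinearMap.range A.mulVecLin = ⊤ :=
    Submodule.eq_top_of_finrank_eq (by simpa [Matrix.rank] using hA)
  exact LinearMap.range_eq_top.mp hrange

/-- The matrix `V(t,τ)` applied to the stacked (column-major) entries of the precoding
matrices computes the differences `h_{ν m'} s_{ν m} - h_{ν m} s_{ν m'}`. -/
theorem Vmat_mulVec_apply {N M J : ℕ} {L : Fin J → ℕ} {n₀ : Fin N} {m' : Fin M}
    (g : Fin N → ∀ j : Fin J, Fin (L j) → ℂ)
    (f : ∀ j : Fin J, Fin M → Fin (L j) → ℂ) (h : Fin N → Fin M → ℂ)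
    (x : (Σ j : Fin J, Fin (L j) × Fin (L j)) → ℂ)
    (p : {n : Fin N // n ≠ n₀} × {m : Fin M // m ≠ m'}) :
    (Vmat N M J L n₀ m' g f h).mulVec x p =
      h p.1 m' * (∑ j, g p.1 j ⬝ᵥ (Matrix.of fun a b => x ⟨j, b, a⟩).mulVec (f j p.2))
        - h p.1 p.2 * ∑ j, g p.1 j ⬝ᵥ (Matrix.of fun a b => x ⟨j, b, a⟩).mulVec (f j m') := by
  simp only [Vmat, Matrix.mulVec, dotProduct, Matrix.of_apply, Fintype.sum_sigma,
    Fintype.sum_prod_type_right, Finset.mul_sum, ← Finset.sum_sub_distrib]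
  refine Finset.sum_congr rfl fun j _ => Finset.sum_congr rfl fun a _ =>
    Finset.sum_congr rfl fun b _ => ?_
  ring

/-- Fix a receiver `n` and a time slot `t ∈ {N+1,…,T}` (encoded by
`t : Fin (M−1)`), with `m' = t − N`.  If for each `τ ∈ {1,…,N}` the alignment
matrix `V(t,τ)` has full row rank `(N−1)(M−1)`, then there exist relay
precoding matrices `R_j(t,τ)` such that for every receiver `ν`, every
`τ ≠ ν` and every `m ≠ m'` the interference-alignment condition
`(s_{ν m'}(t,τ) + h_{ν m'}(t)) / h_{ν m'}(τ) = s_{ν m}(t,τ) / h_{ν m}(τ)`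
holds, where `s_{ν m}(t,τ) = ∑ j, g_{ν j}ᵀ(t) R_j(t,τ) f_{j m}(τ)`. -/
theorem exists_precoding_alignment {M N J : ℕ} (hM : 2 ≤ M) (hN : 2 ≤ N)
    (hJ : 1 ≤ J) (L : Fin J → ℕ) (hLpos : ∀ j, 1 ≤ L j)
    (hL : (N - 1) * (M - 1) ≤ ∑ j, L j ^ 2)
    (n : Fin N) (t : Fin (M - 1)) (m' : Fin M)
    (hm' : m' = Fin.castLE (Nat.sub_le M 1) t)
    (h : Fin N → Fin M → Fin N → ℂ)          -- h ν m τ  :  h_{νm}(τ)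
    (hne : ∀ ν m τ, h ν m τ ≠ 0)
    (c : Fin N → ℂ)                           -- c ν  :  h_{νm'}(t)
    (f : Fin N → ∀ j : Fin J, Fin M → Fin (L j) → ℂ)   -- f τ j m  :  f_{jm}(τ)
    (g : Fin N → ∀ j : Fin J, Fin (L j) → ℂ)           -- g ν j  :  g_{νj}(t)
    (hrank : ∀ τ : Fin N,
      (Vmat N M J L τ m' g (f τ) (fun ν m => h ν m τ)).rank
        = (N - 1) * (M - 1)) :
    ∃ R : Fin N → ∀ j : Fin J, Matrix (Fin (L j)) (Fin (L j)) ℂ,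
      ∀ ν τ : Fin N, τ ≠ ν → ∀ m : Fin M, m ≠ m' →
        ((∑ j, g ν j ⬝ᵥ (R τ j).mulVec (f τ j m')) + c ν) / h ν m' τ
          = (∑ j, g ν j ⬝ᵥ (R τ j).mulVec (f τ j m)) / h ν m τ := by
  have hsol : ∀ τ : Fin N, ∃ x, (Vmat N M J L τ m' g (f τ) fun ν m => h ν m τ).mulVec x =
      fun p => h p.1 p.2 τ * c p.1 := fun τ =>
    Matrix.mulVec_surjective_of_rank_eq_card
      (by simp [hrank τ, Fintype.card_subtype_compl]) _
  choose x hx using hsol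
  refine ⟨fun τ j => Matrix.of fun a b => x τ ⟨j, b, a⟩, fun ν τ hτ m hm => ?_⟩
  have key := congrFun (hx τ) (⟨ν, hτ.symm⟩, ⟨m, hm⟩)
  rw [Vmat_mulVec_apply] at key
  rw [div_eq_div_iff (hne ν m' τ) (hne ν m τ)]
  linear_combination -key
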